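/- Let q be a prime with q ≡ 1 (mod 3). If there exists a family of q-product blocks in which every block has exactly k elements (a (q,k)-PB), then there exists a set S of permutations of {0, 1, ..., q-1} with |S| ≥ q(q-1)(k+1) such that any two distinct permutations in S differ in at least q-3 positions. -/

import Mathlib

open Finset

/-- The permutation `x ↦ u * (x + b)`. -/
def affinePerm {K : Type*} [Field K] (u : Kˣ) (b : K) : Equiv.Perm K :=
  (Equiv.addRight b).trans u.mulLeft

/-- The permutation `x ↦ u * (b + (x - s)⁻¹)`, with the convention `0⁻¹ = 0`. -/
def fractionalPerm {K : Type*} [Field K] (u : Kˣ) (s b : K) : Equiv.Perm K :=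
  (Equiv.subRight s).trans ((Equiv.inv K).trans ((Equiv.addLeft b).trans u.mulLeft))

theorem affinePerm_apply {K : Type*} [Field K] (u : Kˣ) (b x : K) :
    affinePerm u b x = u * (x + b) := rfl

theorem fractionalPerm_apply {K : Type*} [Field K] (u : Kˣ) (s b x : K) :
    fractionalPerm u s b x = u * (b + (x - s)⁻¹) := rfl

section AgreementBounds

variable {K : Type*} [Field K] [Fintype K] [DecidableEq K]

theorem card_filter_quadratic_eq_zero_le_two (a b c : K) (h : ¬(a = 0 ∧ b = 0 ∧ c = 0)) :
    #{x : K | a * x ^ 2 + b * x + c = 0} ≤ 2 := by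
  set p : Polynomial K := .C a * .X ^ 2 + .C b * .X + .C c with hp
  have hp0 : p ≠ 0 := by
    intro h0
    have h2 := congrArg (Polynomial.coeff · 2) h0
    have h1 := congrArg (Polynomial.coeff · 1) h0
    have h00 := congrArg (Polynomial.coeff · 0) h0
    simp [hp, Polynomial.coeff_X, Polynomial.coeff_C] at h2 h1 h00
    exact h ⟨h2, h1, h00⟩
  calc #{x : K | a * x ^ 2 + b * x + c = 0} ≤ #p.roots.toFinset := by
        refine card_le_card fun x hx => ?_
        rw [Multiset.mem_toFinset, Polynomial.mem_roots hp0]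
        simpa [hp] using hx
    _ ≤ p.roots.card := Multiset.toFinset_card_le _
    _ ≤ p.natDegree := p.card_roots'
    _ ≤ 2 := Polynomial.natDegree_quadratic_le

/-- If `f` and `g` agree off a single point only at zeros of a nonzero polynomial of degree at
most two, then they agree in at most three points. -/
theorem card_agreement_le_three {α : Type*} [DecidableEq α] (f g : K → α) (s a b c : K)
    (h : ¬(a = 0 ∧ b = 0 ∧ c = 0))
    (hfg : ∀ x, x ≠ s → f x = g x → a * x ^ 2 + b * x + c = 0) :
    #{x | f x = g x} ≤ 3 := by
  have hsub : ({x | f x = g x} : Finset K) ⊆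
      insert s ({x | a * x ^ 2 + b * x + c = 0} : Finset K) := by
    intro x hx
    by_cases hxs : x = s
    · simp [hxs]
    · simp only [mem_filter, mem_univ, true_and] at hx
      simp [hfg x hxs hx]
  have := card_le_card hsub
  have := card_insert_le s ({x | a * x ^ 2 + b * x + c = 0} : Finset K)
  have := card_filter_quadratic_eq_zero_le_two a b c h
  omega

theorem card_agreement_affinePerm_le (u v : Kˣ) (b c : K) (h : ¬(u = v ∧ b = c)) :
    #{x | affinePerm u b x = affinePerm v c x} ≤ 3 := by
  refine card_agreement_le_three _ _ 0 0 (u - v) (u * b - v * c) ?_ ?_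
  · rintro ⟨-, h1, h2⟩
    have huv : u = v := Units.ext (sub_eq_zero.1 h1)
    subst huv
    exact h ⟨rfl, mul_left_cancel₀ u.ne_zero (sub_eq_zero.1 h2)⟩
  · intro x _ hx
    simp only [affinePerm_apply] at hx
    linear_combination hx

theorem card_agreement_affinePerm_fractionalPerm_le (u v : Kˣ) (b s c : K) :
    #{x | affinePerm u b x = fractionalPerm v s c x} ≤ 3 := by
  refine card_agreement_le_three _ _ s u (u * b - u * s - v * c)
    (-(u * b * s) + v * c * s - v) (fun h => u.ne_zero h.1) ?_
  intro x hxs hx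
  have hx0 : x - s ≠ 0 := sub_ne_zero.2 hxs
  simp only [affinePerm_apply, fractionalPerm_apply] at hx
  field_simp at hx
  linear_combination hx

theorem card_agreement_fractionalPerm_le_of_ne (u v : Kˣ) (s t b c x₀ : K) (hst : s ≠ t)
    (hx₀ : ∀ x, x = s ∨ x = t → fractionalPerm u s b x = fractionalPerm v t c x → x = x₀) :
    #{x | fractionalPerm u s b x = fractionalPerm v t c x} ≤ 3 := by
  refine card_agreement_le_three _ _ x₀ (u * b - v * c)
    (-(u * b - v * c) * (s + t) + u - v) ((u * b - v * c) * s * t - u * t + v * s) ?_ ?_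
  · rintro ⟨h1, h2, h3⟩
    have huv : (u : K) = v := by linear_combination h2 + (s + t) * h1
    have : (u : K) * (s - t) = 0 := by linear_combination h3 - s * t * h1 + s * huv
    exact (mul_ne_zero u.ne_zero (sub_ne_zero.2 hst)) this
  · intro x hx hfx
    have hxs : x - s ≠ 0 := fun h => hx (hx₀ x (.inl (sub_eq_zero.1 h)) hfx)
    have hxt : x - t ≠ 0 := fun h => hx (hx₀ x (.inr (sub_eq_zero.1 h)) hfx)
    simp only [fractionalPerm_apply] at hfx
    field_simp at hfx
    linear_combination hfx

theorem card_agreement_fractionalPerm_le (u v : Kˣ) (s t b c : K)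
    (h : ¬(u = v ∧ s = t ∧ b = c)) (hbc : (c - b) * (t - s) ≠ 1) :
    #{x | fractionalPerm u s b x = fractionalPerm v t c x} ≤ 3 := by
  by_cases hst : s = t
  · subst hst
    refine card_agreement_le_three _ _ s 0 (u * b - v * c)
      (-(u * b - v * c) * s + u - v) ?_ ?_
    · rintro ⟨-, h1, h2⟩
      have huv : u = v := Units.ext (by linear_combination h2 + s * h1)
      subst huv
      exact h ⟨rfl, rfl, mul_left_cancel₀ u.ne_zero (sub_eq_zero.1 h1)⟩
    · intro x hxs hx
      have hx0 : x - s ≠ 0 := sub_ne_zero.2 hxs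
      simp only [fractionalPerm_apply] at hx
      field_simp at hx
      linear_combination hx
  · by_cases hs : fractionalPerm u s b s = fractionalPerm v t c s
    · refine card_agreement_fractionalPerm_le_of_ne u v s t b c s hst ?_
      rintro x (rfl | rfl) hx
      · rfl
      · exfalso
        have h1 : s - x ≠ 0 := sub_ne_zero.2 hst
        have h2 : x - s ≠ 0 := sub_ne_zero.2 (Ne.symm hst)
        simp only [fractionalPerm_apply, sub_self, inv_zero, add_zero] at hs hx
        field_simp at hs hx
        have huv : (u : K) = v := by linear_combination hs + hx
        rw [huv] at hx
        apply hbc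
        apply mul_left_cancel₀ v.ne_zero
        linear_combination -hx
    · refine card_agreement_fractionalPerm_le_of_ne u v s t b c t hst ?_
      rintro x (rfl | rfl) hx
      · exact absurd hx hs
      · rfl

end AgreementBounds

/-- A family of permutations any two of which agree in few points yields a large set of
permutations of `Fin n` with large pairwise Hamming distance. -/
theorem exists_finset_perm_of_card_agreement_le {ι α : Type*} [Fintype ι] [Fintype α]
    [DecidableEq α] (n d : ℕ) (hn : Fintype.card α = n) (hd : d < n) (F : ι → Equiv.Perm α)
    (hF : ∀ i j, i ≠ j → #{x | F i x = F j x} ≤ d) :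
    ∃ S : Finset (Equiv.Perm (Fin n)), Fintype.card ι ≤ S.card ∧
      ∀ σ ∈ S, ∀ τ ∈ S, σ ≠ τ → n - d ≤ #{x | σ x ≠ τ x} := by
  have hinj : Function.Injective F := by
    intro i j hij
    by_contra hne
    have := hF i j hne
    simp [hij, hn] at this
    omega
  let e : α ≃ Fin n := Fintype.equivFinOfCardEq hn
  refine ⟨univ.map ⟨fun i => e.permCongr (F i), e.permCongr.injective.comp hinj⟩, by simp, ?_⟩
  simp only [mem_map, mem_univ, true_and, Function.Embedding.coeFn_mk]
  rintro _ ⟨i, rfl⟩ _ ⟨j, rfl⟩ hne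
  have hcard : #{x | e.permCongr (F i) x = e.permCongr (F j) x} = #{x | F i x = F j x} :=
    card_equiv e.symm (by simp)
  have hij := hF i j (by rintro rfl; exact hne rfl)
  have hsum := card_filter_add_card_filter_not (s := (univ : Finset (Fin n)))
    (fun x => e.permCongr (F i) x = e.permCongr (F j) x)
  rw [card_univ, Fintype.card_fin, hcard] at hsum
  simp only [ne_eq]
  omega


/-- Let `q` be a prime with `q ≡ 1 (mod 3)`. If a `(q,k)`-PB exists, i.e. a family of
`q`-product blocks in which every block has exactly `k` elements, then
`M(q, q-3) ≥ q(q-1)(k+1)`: there is a set of at least `q(q-1)(k+1)` permutations of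
`{0, …, q-1}` any two distinct members of which differ in at least `q - 3` positions. -/
theorem fixed_size_product_blocks_lower_bound (q k : ℕ) [Fact q.Prime] (h3 : q % 3 = 1)
    (B : ZMod q → Finset (ZMod q))
    (hPB : ∀ r s : ZMod q, ∀ a ∈ B r, ∀ b ∈ B s, (b - a) * (s - r) ≠ 1)
    (hk : ∀ s : ZMod q, (B s).card = k) :
    ∃ S : Finset (Equiv.Perm (Fin q)),
      q * (q - 1) * (k + 1) ≤ S.card ∧
      ∀ σ ∈ S, ∀ τ ∈ S, σ ≠ τ →
        q - 3 ≤ (Finset.univ.filter (fun x => σ x ≠ τ x)).card := by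
  have hq : 3 < q := by
    have h2 := (Fact.out : q.Prime).two_le
    omega
  let F : (ZMod q)ˣ × (ZMod q ⊕ Σ s, B s) → Equiv.Perm (ZMod q) := fun i =>
    Sum.elim (affinePerm i.1) (fun p => fractionalPerm i.1 p.1 p.2) i.2
  obtain ⟨S, hS, hdist⟩ := exists_finset_perm_of_card_agreement_le q 3 (ZMod.card q) hq F (by
    rintro ⟨u, b | ⟨s, b, hb⟩⟩ ⟨v, c | ⟨t, c, hc⟩⟩ hne
    · exact card_agreement_affinePerm_le u v b c (by rintro ⟨rfl, rfl⟩; exact hne rfl)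
    · exact card_agreement_affinePerm_fractionalPerm_le u v b t c
    · simpa only [F, Sum.elim_inl, Sum.elim_inr, eq_comm] using
        card_agreement_affinePerm_fractionalPerm_le v u c s b
    · exact card_agreement_fractionalPerm_le u v s t b c
        (by rintro ⟨rfl, rfl, rfl⟩; exact hne rfl) (hPB s t b hb c hc))
  refine ⟨S, le_of_eq_of_le ?_ hS, hdist⟩
  simp only [Fintype.card_prod, ZMod.card_units, Fintype.card_sum, ZMod.card, Fintype.card_sigma,
    Fintype.card_coe, hk, sum_const, card_univ, smul_eq_mul]
  ring
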